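/- arXiv:2603.09144 — 6 statements merged into one kernel-verified Lean document; each statement's English description precedes it below -/
import Mathlib

section
/- Let G = (V, E, w) be a finite undirected edge-weighted graph (possibly with self-loops but no parallel edges), let A₁ and A₂ be two 2-matchings of G, and let ε ∈ (0, 1] be a constant. If (1−ε)·w(A₁) > w(A₂), then there exists an alternating trail P w.r.t. (A₁, A₂) such that: (1) A₂ΔP is a 2-matching, (2) w(A₂ΔP) > w(A₂), and (3) |P| ≤ 3/ε. -/
open Finset

variable {V : Type*}

/-- Degree of a vertex w.r.t. an edge set, self-loops counted twice. -/
def sym2Deg [DecidableEq V] (F : Finset (Sym2 V)) (v : V) : ℕ :=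
  ∑ e ∈ F, (if e = s(v, v) then 2 else if v ∈ e then 1 else 0)

def IsTwoMatching [DecidableEq V] (F : Finset (Sym2 V)) : Prop :=
  ∀ v : V, sym2Deg F v ≤ 2

def IsTriangle [DecidableEq V] (T : Finset (Sym2 V)) : Prop :=
  ∃ a b c : V, a ≠ b ∧ a ≠ c ∧ b ≠ c ∧ T = {s(a, b), s(b, c), s(a, c)}

def TriangleFree [DecidableEq V] (F : Finset (Sym2 V)) : Prop :=
  ∀ T : Finset (Sym2 V), IsTriangle T → ¬ T ⊆ F

def TFree [DecidableEq V] (𝒯 : Finset (Finset (Sym2 V))) (F : Finset (Sym2 V)) : Prop :=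
  ∀ T ∈ 𝒯, ¬ T ⊆ F

def wSum (w : Sym2 V → ℚ) (F : Finset (Sym2 V)) : ℚ := ∑ e ∈ F, w e

/-- A trail of length `k` in an edge set `E`: a sequence of distinct consecutive edges. -/
def IsTrail [DecidableEq V] (E : Finset (Sym2 V)) (k : ℕ) (u : ℕ → V) : Prop :=
  (∀ i < k, s(u i, u (i + 1)) ∈ E) ∧
  (∀ i < k, ∀ j < k, s(u i, u (i + 1)) = s(u j, u (j + 1)) → i = j)

def trailEdges [DecidableEq V] (k : ℕ) (u : ℕ → V) : Finset (Sym2 V) :=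
  (Finset.range k).image (fun i => s(u i, u (i + 1)))

def trailSl [DecidableEq V] (k : ℕ) (u : ℕ → V) : ℕ :=
  ((Finset.range k).filter (fun i => u i = u (i + 1))).card

def IsAltTrail [DecidableEq V] (A₁ A₂ : Finset (Sym2 V)) (k : ℕ) (u : ℕ → V) : Prop :=
  IsTrail (symmDiff A₁ A₂) k u ∧
  ∀ i, i + 1 < k →
    (s(u i, u (i + 1)) ∈ A₁ \ A₂ ↔ s(u (i + 1), u (i + 2)) ∈ A₂ \ A₁)

/-- Half-edges sharing an endpoint can be paired off, with opposite colours in each pair, so that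
all the unpaired half-edges (the fixed points of the pairing) at a common endpoint have the same
colour. -/
theorem exists_maximal_pairing {H W : Type*} [Finite H] (c : H → Bool) (p : H → W) :
    ∃ σ : H → H, Function.Involutive σ ∧ (∀ h, p (σ h) = p h) ∧
      (∀ h, σ h ≠ h → c (σ h) = !c h) ∧
      ∀ a b, p a = p b → σ a = a → σ b = b → c a = c b := by
  classical
  have := Fintype.ofFinite H
  let S : Finset (H → H) := Finset.univ.filter fun σ =>
    Function.Involutive σ ∧ (∀ h, p (σ h) = p h) ∧ (∀ h, σ h ≠ h → c (σ h) = !c h)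
  have hS : S.Nonempty := ⟨id, Finset.mem_filter.2
    ⟨Finset.mem_univ _, fun _ => rfl, fun _ => rfl, fun _ h => absurd rfl h⟩⟩
  obtain ⟨σ, hσS, hmax⟩ :=
    S.exists_max_image (fun σ => (Finset.univ.filter fun h => σ h ≠ h).card) hS
  obtain ⟨hinv, hp, hc⟩ : Function.Involutive σ ∧ (∀ h, p (σ h) = p h) ∧
      (∀ h, σ h ≠ h → c (σ h) = !c h) := by simpa [S] using hσS
  refine ⟨σ, hinv, hp, hc, fun a b hab ha hb => ?_⟩
  by_contra hcab
  have hne : a ≠ b := fun h => hcab (by rw [h])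
  have hcb : c b = !c a := by cases h1 : c a <;> cases h2 : c b <;> simp_all
  let ψ : H → H := fun h => if h = a then b else if h = b then a else σ h
  have hsa : ∀ h, h ≠ a → σ h ≠ a := fun h h1 h2 => h1 (by rw [← hinv h, h2, ha])
  have hsb : ∀ h, h ≠ b → σ h ≠ b := fun h h1 h2 => h1 (by rw [← hinv h, h2, hb])
  have hψS : ψ ∈ S := by
    simp only [S, Finset.mem_filter, Finset.mem_univ, true_and]
    refine ⟨fun h => ?_, fun h => ?_, fun h => ?_⟩
    · by_cases h1 : h = a
      · simp [ψ, h1]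
      · by_cases h2 : h = b
        · simp [ψ, h2]
        · simp [ψ, h1, h2, hsa h h1, hsb h h2, hinv h]
    · by_cases h1 : h = a
      · simp [ψ, h1, hab]
      · by_cases h2 : h = b
        · simp [ψ, h2, hne.symm, hab]
        · simp [ψ, h1, h2, hp]
    · by_cases h1 : h = a
      · simp [ψ, h1, hcb]
      · by_cases h2 : h = b
        · simp [ψ, h2, hne.symm, hcb]
        · simpa [ψ, h1, h2] using hc h
  refine absurd (hmax ψ hψS) (not_le.mpr (Finset.card_lt_card ?_))
  refine Finset.ssubset_iff_of_subset (fun h hh => ?_) |>.mpr ⟨a, ?_, ?_⟩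
  · simp only [Finset.mem_filter, Finset.mem_univ, true_and] at hh ⊢
    have h1 : h ≠ a := fun h1 => hh (by rw [h1, ha])
    have h2 : h ≠ b := fun h1 => hh (by rw [h1, hb])
    simpa [ψ, h1, h2] using hh
  · simp [ψ, hne.symm]
  · simp [ha]

section Segments

variable {H : Type*}

/-- The gain collected from `h` on by a walk of at most `r` half-edges, which crosses an edge by
`τ`, continues by `σ`, and stops early at a fixed point of `σ`. -/
def walkGain [DecidableEq H] (σ τ : H → H) (g : H → ℚ) : ℕ → H → ℚ
  | 0, _ => 0
  | r + 1, h => g h + if σ (τ h) = τ h then 0 else walkGain σ τ g r (σ (τ h))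

/-- The first `n` half-edges of the walk from `h` can be exchanged: at either end the walk has a
half-edge of colour `false` or an unpaired one, or else the walk closes up. -/
structure IsExchangeable (σ τ : H → H) (c : H → Bool) (h : H) (n : ℕ) : Prop where
  paired : ∀ i, i + 1 < n → σ (τ ((σ ∘ τ)^[i] h)) ≠ τ ((σ ∘ τ)^[i] h)
  ends : ((c h = false ∨ σ h = h) ∧ ∀ m, n = m + 1 →
      (c ((σ ∘ τ)^[m] h) = false ∨ σ (τ ((σ ∘ τ)^[m] h)) = τ ((σ ∘ τ)^[m] h))) ∨
    ((σ ∘ τ)^[n] h = h ∧ ∀ i < n, σ (τ ((σ ∘ τ)^[i] h)) ≠ τ ((σ ∘ τ)^[i] h))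

theorem exists_walkGain_eq_sum [DecidableEq H] {σ τ : H → H} {c : H → Bool} (g : H → ℚ)
    (hcτ : ∀ h, c (τ h) = c h) (hcσ : ∀ h, σ h ≠ h → c (σ h) = !c h) (r : ℕ) :
    ∀ h, c h = !r.bodd → ∃ n ≤ r, (0 < r → 0 < n) ∧
      walkGain σ τ g r h = ∑ i ∈ Finset.range n, g ((σ ∘ τ)^[i] h) ∧
      (∀ i, i + 1 < n → σ (τ ((σ ∘ τ)^[i] h)) ≠ τ ((σ ∘ τ)^[i] h)) ∧
      ∀ m, n = m + 1 →
        (c ((σ ∘ τ)^[m] h) = false ∨ σ (τ ((σ ∘ τ)^[m] h)) = τ ((σ ∘ τ)^[m] h)) := by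
  induction r with
  | zero => exact fun h _ => ⟨0, by simp [walkGain]⟩
  | succ r ih =>
    intro h hch
    by_cases hst : σ (τ h) = τ h
    · refine ⟨1, by omega, by simp, by simp [walkGain, hst], by simp, fun m hm => ?_⟩
      obtain rfl : m = 0 := by omega
      exact Or.inr hst
    · have hc' : c (σ (τ h)) = !r.bodd := by
        rw [hcσ _ hst, hcτ, hch, Nat.bodd_succ, Bool.not_not]
      obtain ⟨n, hn, hpos, hsum, hpair, hend⟩ := ih _ hc'
      refine ⟨n + 1, by omega, by simp, ?_, ?_, ?_⟩
      · rw [Finset.sum_range_succ']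
        simp [walkGain, hst, hsum, add_comm]
      · rintro (_ | i) hi
        · exact hst
        · exact hpair i (by omega)
      · rintro (_ | m) hm
        · obtain rfl : r = 0 := by
            by_contra hr
            have := hpos (by omega)
            omega
          exact Or.inl (by simpa using hch)
        · exact hend m (by omega)

theorem add_le_sum_walkGain_succ [Fintype H] [DecidableEq H] {σ τ : H → H} {c : H → Bool} (g : H → ℚ)
    (hσ : Function.Involutive σ) (hτ : Function.Involutive τ)
    (hcτ : ∀ h, c (τ h) = c h) (hcσ : ∀ h, σ h ≠ h → c (σ h) = !c h) (r : ℕ)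
    (hr : ∀ h, c h = (!r.bodd) → σ h = h → walkGain σ τ g r h ≤ 0) :
    (∑ h, if c h = r.bodd then g h else 0) +
        (∑ h, if c h = !r.bodd then walkGain σ τ g r h else 0) ≤
      ∑ h, if c h = r.bodd then walkGain σ τ g (r + 1) h else 0 := by
  let k : H → ℚ := fun h =>
    if σ h = h then 0 else if c h = !r.bodd then walkGain σ τ g r h else 0
  have hk : ∑ h, k (σ (τ h)) = ∑ h, k h :=
    Equiv.sum_comp (hτ.toPerm.trans hσ.toPerm) k
  have h1 : ∑ h, (if c h = !r.bodd then walkGain σ τ g r h else 0) ≤ ∑ h, k (σ (τ h)) := by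
    rw [hk]
    refine Finset.sum_le_sum fun h _ => ?_
    by_cases h2 : σ h = h
    · by_cases h3 : c h = !r.bodd
      · simpa [k, h2, h3] using hr h h3 h2
      · simp [k, h2, h3]
    · simp [k, h2]
  have h2 : ∑ h, (if c h = r.bodd then walkGain σ τ g (r + 1) h else 0) =
      (∑ h, if c h = r.bodd then g h else 0) + ∑ h, k (σ (τ h)) := by
    rw [← Finset.sum_add_distrib]
    refine Finset.sum_congr rfl fun h _ => ?_
    by_cases h3 : σ (τ h) = τ h
    · have : k (σ (τ h)) = 0 := by simp [k, h3]
      rw [this, add_zero]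
      simp [walkGain, h3]
    · have h4 : σ (σ (τ h)) ≠ σ (τ h) := by rw [hσ]; exact Ne.symm h3
      have h5 : c (σ (τ h)) = !c h := by rw [hcσ _ h3, hcτ]
      by_cases h6 : c h = r.bodd
      · simp [k, h3, h4, h5, h6, walkGain]
      · have h7 : (!c h) ≠ !r.bodd := by simpa using h6
        simp [k, h4, h5, h6]
  rw [h2]
  linarith

/-- An averaging argument over all walks with at most `s + 1` half-edges of colour `false` gives one
with positive gain. -/
theorem exists_isExchangeable_of_sum_pos [Fintype H] {σ τ : H → H} {c : H → Bool} (g : H → ℚ)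
    (hσ : Function.Involutive σ) (hτ : Function.Involutive τ)
    (hcτ : ∀ h, c (τ h) = c h) (hcσ : ∀ h, σ h ≠ h → c (σ h) = !c h) (s : ℕ)
    (hpos : 0 < (s + 1) * (∑ h, if c h = false then g h else 0) +
      s * ∑ h, if c h = true then g h else 0) :
    ∃ n ≤ 2 * s + 1, ∃ h, IsExchangeable σ τ c h n ∧
      0 < ∑ i ∈ Finset.range n, g ((σ ∘ τ)^[i] h) := by
  classical
  by_contra! hcon
  have hle : ∀ r ≤ 2 * s + 1, ∀ h, c h = (!r.bodd) → (c h = false ∨ σ h = h) →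
      walkGain σ τ g r h ≤ 0 := by
    intro r hr h hch hstart
    obtain ⟨n, hn, -, hsum, hpair, hend⟩ := exists_walkGain_eq_sum g hcτ hcσ r h hch
    rw [hsum]
    exact hcon n (hn.trans hr) h ⟨hpair, Or.inl ⟨hstart, hend⟩⟩
  have key : ∀ q ≤ s, (q + 1) * (∑ h, if c h = false then g h else 0) +
      q * (∑ h, if c h = true then g h else 0) ≤
      ∑ h, if c h = false then walkGain σ τ g (2 * q + 1) h else 0 := by
    intro q
    induction q with
    | zero => intro _; simp [walkGain]
    | succ q ih =>
      intro hq
      have h0 := ih (by omega)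
      have h1 := add_le_sum_walkGain_succ g hσ hτ hcτ hcσ (2 * q + 1)
        (fun h hc hh => hle _ (by omega) h hc (Or.inr hh))
      have h2 := add_le_sum_walkGain_succ g hσ hτ hcτ hcσ (2 * q + 2)
        (fun h hc hh => hle _ (by omega) h hc (Or.inr hh))
      have b1 : (2 * q + 1).bodd = true := by simp
      have b2 : (2 * q + 2).bodd = false := by simp
      rw [b1] at h1
      rw [b2] at h2
      simp only [Bool.not_true, Bool.not_false] at h1 h2
      have e : 2 * (q + 1) + 1 = 2 * q + 2 + 1 := by ring
      rw [e]
      push_cast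
      linarith
  refine absurd (hpos.trans_le (key s le_rfl)) (not_lt.mpr (Finset.sum_nonpos fun h _ => ?_))
  split_ifs with hc
  · exact hle _ le_rfl h (by simp [hc]) (Or.inl hc)
  · exact le_rfl

theorem iterate_ne_involution_iterate {σ τ : H → H} {c : H → Bool}
    (hσ : Function.Involutive σ) (hτ : Function.Involutive τ) (hτne : ∀ h, τ h ≠ h)
    (hcτ : ∀ h, c (τ h) = c h) (hcσ : ∀ h, σ h ≠ h → c (σ h) = !c h) {h : H} {n : ℕ}
    (hpair : ∀ i, i + 1 < n → σ (τ ((σ ∘ τ)^[i] h)) ≠ τ ((σ ∘ τ)^[i] h)) (d : ℕ) :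
    ∀ i, i + d < n → (σ ∘ τ)^[i] h ≠ τ ((σ ∘ τ)^[i + d] h) := by
  induction d using Nat.strong_induction_on with
  | _ d ih =>
    intro i hi heq
    match d with
    | 0 => exact hτne _ heq.symm
    | 1 =>
      have h1 := congrArg c heq
      rw [hcτ, Function.iterate_succ_apply', Function.comp_apply, hcσ _ (hpair i hi), hcτ] at h1
      simp at h1
    | d + 2 =>
      refine ih d (by omega) (i + 1) (by omega) ?_
      rw [Function.iterate_succ_apply', Function.comp_apply, heq, hτ,
        show i + (d + 2) = (i + 1 + d) + 1 by omega, Function.iterate_succ_apply',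
        Function.comp_apply, hσ]

/-- A shortest exchangeable walk with positive gain visits no half-edge twice. -/
theorem exists_isExchangeable_injOn {σ τ : H → H} {c : H → Bool} (g : H → ℚ)
    (hσ : Function.Involutive σ) (hτ : Function.Involutive τ) {N : ℕ}
    (hex : ∃ n ≤ N, ∃ h, IsExchangeable σ τ c h n ∧
      0 < ∑ i ∈ Finset.range n, g ((σ ∘ τ)^[i] h)) :
    ∃ n ≤ N, ∃ h, IsExchangeable σ τ c h n ∧
      0 < ∑ i ∈ Finset.range n, g ((σ ∘ τ)^[i] h) ∧
      ∀ i j, i < j → j < n → (σ ∘ τ)^[i] h ≠ (σ ∘ τ)^[j] h := by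
  classical
  obtain ⟨n₀, hn₀, hex'⟩ := hex
  have hex'' : ∃ n, ∃ h, IsExchangeable σ τ c h n ∧
      0 < ∑ i ∈ Finset.range n, g ((σ ∘ τ)^[i] h) := ⟨n₀, hex'⟩
  obtain ⟨h, hseg, hgain⟩ := Nat.find_spec hex''
  have hmin : ∀ m < Nat.find hex'', ∀ h, IsExchangeable σ τ c h m →
      ∑ i ∈ Finset.range m, g ((σ ∘ τ)^[i] h) ≤ 0 := fun m hm h hs => by
    by_contra! hlt
    exact Nat.find_min hex'' hm ⟨h, hs, hlt⟩
  refine ⟨Nat.find hex'', (Nat.find_min' hex'' hex').trans hn₀, h, hseg, hgain, ?_⟩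
  generalize Nat.find hex'' = n at hseg hgain hmin
  intro i j hij hj heq
  obtain ⟨p, rfl⟩ : ∃ p, j = i + p := ⟨j - i, by omega⟩
  obtain ⟨q, rfl⟩ : ∃ q, n = p + q := ⟨n - p, by omega⟩
  have hper : (σ ∘ τ)^[p] h = h := by
    rw [Function.iterate_add_apply] at heq
    exact ((hσ.injective.comp hτ.injective).iterate i heq).symm
  have hshift : ∀ k, (σ ∘ τ)^[p + k] h = (σ ∘ τ)^[k] h := fun k => by
    rw [add_comm, Function.iterate_add_apply, hper]
  have hgp := hmin p (by omega) h
    ⟨fun k hk => hseg.paired k (by omega), Or.inr ⟨hper, fun k hk => hseg.paired k (by omega)⟩⟩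
  have hgq := hmin q (by omega) h ⟨fun k hk => hseg.paired k (by omega), by
    rcases hseg.ends with ⟨hs, he⟩ | ⟨hcl, hall⟩
    · refine Or.inl ⟨hs, fun m hm => ?_⟩
      rw [← hshift m]
      exact he (p + m) (by omega)
    · exact Or.inr ⟨by rw [← hshift q, hcl], fun k hk => hall k (by omega)⟩⟩
  rw [Finset.sum_range_add] at hgain
  simp only [hshift] at hgain
  linarith

/-- The edges of an exchangeable walk contain the partner of each of their paired half-edges of
colour `true`. -/
theorem IsExchangeable.exists_partner {σ τ : H → H} {c : H → Bool} {h : H} {n : ℕ}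
    (hs : IsExchangeable σ τ c h n) (hσ : Function.Involutive σ)
    (hcτ : ∀ h, c (τ h) = c h) {x : H} (hcx : c x = true) (hx : σ x ≠ x)
    (hxmem : ∃ i < n, x = (σ ∘ τ)^[i] h ∨ x = τ ((σ ∘ τ)^[i] h)) :
    ∃ i < n, σ x = (σ ∘ τ)^[i] h ∨ σ x = τ ((σ ∘ τ)^[i] h) := by
  obtain ⟨i, hi, rfl | rfl⟩ := hxmem
  · cases i with
    | succ i =>
      refine ⟨i, by omega, Or.inr ?_⟩
      rw [Function.iterate_succ_apply', Function.comp_apply, hσ]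
    | zero =>
      rcases hs.ends with ⟨hst, -⟩ | ⟨hcl, -⟩
      · rcases hst with hst | hst
        · simp [hst] at hcx
        · exact absurd hst hx
      · obtain ⟨m, rfl⟩ : ∃ m, n = m + 1 := ⟨n - 1, by omega⟩
        refine ⟨m, by omega, Or.inr ?_⟩
        rw [Function.iterate_succ_apply', Function.comp_apply] at hcl
        rw [Function.iterate_zero, id_eq, ← hσ (τ _), hcl]
  · rw [hcτ] at hcx
    by_cases hin : i + 1 < n
    · exact ⟨i + 1, hin, Or.inl (by rw [Function.iterate_succ_apply', Function.comp_apply])⟩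
    · rcases hs.ends with ⟨-, he⟩ | ⟨hcl, -⟩
      · rcases he i (by omega) with he | he
        · simp [he] at hcx
        · exact absurd he hx
      · refine ⟨0, by omega, Or.inl ?_⟩
        rw [show n = i + 1 by omega, Function.iterate_succ_apply'] at hcl
        simpa using hcl

end Segments

/-- The endpoint of the half-edge `(e, b)`. -/
noncomputable def halfEdgeEnd (e : Sym2 V) (b : Bool) : V := if b then e.out.1 else e.out.2

theorem mk_halfEdgeEnd (e : Sym2 V) (b : Bool) :
    s(halfEdgeEnd e b, halfEdgeEnd e (!b)) = e := by
  have h : s(e.out.1, e.out.2) = e := Quot.out_eq e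
  cases b
  · simpa [halfEdgeEnd, Sym2.eq_swap] using h
  · simpa [halfEdgeEnd] using h

theorem sym2Deg_eq_card_halfEdges [DecidableEq V] {X F : Finset (Sym2 V)} (hF : F ⊆ X) (v : V) :
    sym2Deg F v =
      (Finset.univ.filter fun h : X × Bool => h.1.1 ∈ F ∧ halfEdgeEnd h.1.1 h.2 = v).card := by
  have hmult : ∀ e : Sym2 V, (if e = s(v, v) then 2 else if v ∈ e then 1 else 0) =
      ∑ b : Bool, if halfEdgeEnd e b = v then 1 else 0 := fun e => by
    have h := mk_halfEdgeEnd e true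
    rw [Fintype.sum_bool]
    rw [Bool.not_true] at h
    generalize halfEdgeEnd e true = x at h ⊢
    generalize halfEdgeEnd e false = y at h ⊢
    subst h
    by_cases hx : x = v <;> by_cases hy : y = v <;>
      simp [hx, hy, eq_comm (a := v)]
  rw [Finset.card_filter, Fintype.sum_prod_type, sym2Deg]
  have : ∀ x : X, (∑ b : Bool, if x.1 ∈ F ∧ halfEdgeEnd x.1 b = v then 1 else 0) =
      if x.1 ∈ F then (if x.1 = s(v, v) then 2 else if v ∈ x.1 then 1 else 0) else 0 := fun x => by
    by_cases hx : x.1 ∈ F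
    · simp only [hx, true_and, if_true, hmult]
    · simp [hx]
  simp only [this]
  rw [Finset.sum_coe_sort X (fun e => if e ∈ F then
    (if e = s(v, v) then 2 else if v ∈ e then 1 else 0) else 0), ← Finset.sum_filter,
    Finset.filter_mem_eq_inter, Finset.inter_eq_right.mpr hF]

theorem sym2Deg_union [DecidableEq V] {F F' : Finset (Sym2 V)} (h : Disjoint F F') (v : V) :
    sym2Deg (F ∪ F') v = sym2Deg F v + sym2Deg F' v :=
  Finset.sum_union h

theorem wSum_union [DecidableEq V] (w : Sym2 V → ℚ) {F F' : Finset (Sym2 V)}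
    (h : Disjoint F F') : wSum w (F ∪ F') = wSum w F + wSum w F' :=
  Finset.sum_union h

theorem sym2Deg_le_of_injective [DecidableEq V] {X F F' : Finset (Sym2 V)} (hF : F ⊆ X)
    (hF' : F' ⊆ X) {σ : X × Bool → X × Bool} (hσ : Function.Injective σ)
    (hp : ∀ h, halfEdgeEnd (σ h).1.1 (σ h).2 = halfEdgeEnd h.1.1 h.2) (v : V)
    (hmap : ∀ h, h.1.1 ∈ F → halfEdgeEnd h.1.1 h.2 = v → (σ h).1.1 ∈ F') :
    sym2Deg F v ≤ sym2Deg F' v := by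
  rw [sym2Deg_eq_card_halfEdges hF, sym2Deg_eq_card_halfEdges hF']
  refine Finset.card_le_card_of_injOn σ (fun h hh => ?_) hσ.injOn
  simp only [Finset.coe_filter, Finset.mem_univ, true_and, Set.mem_ofPred_eq] at hh ⊢
  exact ⟨hmap h hh.1 hh.2, (hp h).trans hh.2⟩

/-- Exchanging along `P` keeps a 2-matching if, in a maximal pairing of half-edges, `P` contains the
partner of each of its paired half-edges from `A₁ \ A₂`. -/
theorem isTwoMatching_symmDiff_of_pairing [DecidableEq V] {A₁ A₂ P : Finset (Sym2 V)}
    (hA₁m : IsTwoMatching A₁) (hA₂m : IsTwoMatching A₂) (hP : P ⊆ symmDiff A₁ A₂)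
    {σ : ↥(symmDiff A₁ A₂) × Bool → ↥(symmDiff A₁ A₂) × Bool}
    (hσ : Function.Involutive σ)
    (hp : ∀ h, halfEdgeEnd (σ h).1.1 (σ h).2 = halfEdgeEnd h.1.1 h.2)
    (hcσ : ∀ h, σ h ≠ h → ((σ h).1.1 ∈ A₁ ↔ h.1.1 ∉ A₁))
    (hmax : ∀ a b, halfEdgeEnd a.1.1 a.2 = halfEdgeEnd b.1.1 b.2 → σ a = a → σ b = b →
      (a.1.1 ∈ A₁ ↔ b.1.1 ∈ A₁))
    (hcl : ∀ h, h.1.1 ∈ A₁ → h.1.1 ∈ P → σ h ≠ h → (σ h).1.1 ∈ P) :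
    IsTwoMatching (symmDiff A₂ P) := by
  have hmem : ∀ h : ↥(symmDiff A₁ A₂) × Bool,
      h.1.1 ∈ A₁ ∧ h.1.1 ∉ A₂ ∨ h.1.1 ∈ A₂ ∧ h.1.1 ∉ A₁ :=
    fun h => Finset.mem_symmDiff.1 h.1.2
  intro v
  have hsplit : symmDiff A₂ P = (A₂ \ P) ∪ (P \ A₂) := rfl
  rw [hsplit, sym2Deg_union disjoint_sdiff_sdiff]
  by_cases hun : ∃ a : ↥(symmDiff A₁ A₂) × Bool,
      a.1.1 ∈ A₁ ∧ halfEdgeEnd a.1.1 a.2 = v ∧ σ a = a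
  · obtain ⟨a, haA, hav, ha⟩ := hun
    have hle : sym2Deg ((A₂ \ A₁) \ P) v ≤ sym2Deg ((A₁ \ A₂) \ P) v := by
      refine sym2Deg_le_of_injective (X := symmDiff A₁ A₂) ?_ ?_ hσ.injective hp v
        fun h hF hv => ?_
      · intro e; simp only [Finset.mem_sdiff, Finset.mem_symmDiff]; tauto
      · intro e; simp only [Finset.mem_sdiff, Finset.mem_symmDiff]; tauto
      · simp only [Finset.mem_sdiff] at hF ⊢
        have hne : σ h ≠ h := fun hh => hF.1.2 ((hmax a h (hav.trans hv.symm) ha hh).1 haA)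
        have h1 := (hcσ h hne).2 hF.1.2
        refine ⟨⟨h1, ?_⟩, fun h2 => hF.2 ?_⟩
        · have := hmem (σ h); tauto
        · have := hcl (σ h) h1 h2 (by rw [hσ]; exact hne.symm)
          rwa [hσ] at this
    have e1 : A₂ \ P = (A₁ ∩ A₂) ∪ (A₂ \ A₁) \ P := by
      ext e
      have := @hP e
      simp only [Finset.mem_sdiff, Finset.mem_symmDiff, Finset.mem_union, Finset.mem_inter] at *
      tauto
    have e2 : A₁ = (A₁ ∩ A₂) ∪ ((A₁ \ A₂) \ P ∪ P \ A₂) := by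
      ext e
      have := @hP e
      simp only [Finset.mem_sdiff, Finset.mem_symmDiff, Finset.mem_union, Finset.mem_inter] at *
      tauto
    have d1 : Disjoint (A₁ ∩ A₂) ((A₂ \ A₁) \ P) := by
      rw [Finset.disjoint_left]; intro e; simp only [Finset.mem_sdiff, Finset.mem_inter]; tauto
    have d2 : Disjoint ((A₁ \ A₂) \ P) (P \ A₂) := by
      rw [Finset.disjoint_left]; intro e; simp only [Finset.mem_sdiff]; tauto
    have d3 : Disjoint (A₁ ∩ A₂) ((A₁ \ A₂) \ P ∪ P \ A₂) := by
      rw [Finset.disjoint_left]; intro e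
      simp only [Finset.mem_sdiff, Finset.mem_inter, Finset.mem_union]; tauto
    have h2 := hA₁m v
    rw [e2, sym2Deg_union d3, sym2Deg_union d2] at h2
    rw [e1, sym2Deg_union d1]
    omega
  · push Not at hun
    have hle : sym2Deg (P \ A₂) v ≤ sym2Deg (P ∩ A₂) v := by
      refine sym2Deg_le_of_injective (X := symmDiff A₁ A₂)
        (Finset.sdiff_subset.trans hP) (Finset.inter_subset_left.trans hP) hσ.injective hp v
        fun h hF hv => ?_
      simp only [Finset.mem_sdiff, Finset.mem_inter] at hF ⊢
      have hA : h.1.1 ∈ A₁ := by have := hmem h; tauto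
      have hne := hun h hA hv
      have h1 := hcσ h hne
      have h2 := hmem (σ h)
      exact ⟨hcl h hA hF.1 hne, by tauto⟩
    have e1 : A₂ = A₂ \ P ∪ P ∩ A₂ := by
      ext e; simp only [Finset.mem_sdiff, Finset.mem_union, Finset.mem_inter]; tauto
    have d1 : Disjoint (A₂ \ P) (P ∩ A₂) := by
      rw [Finset.disjoint_left]; intro e; simp only [Finset.mem_sdiff, Finset.mem_inter]; tauto
    have h2 : sym2Deg A₂ v = sym2Deg (A₂ \ P) v + sym2Deg (P ∩ A₂) v := by
      rw [← sym2Deg_union d1, ← e1]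
    have := hA₂m v
    omega

theorem sum_halfEdges_ite [DecidableEq V] (X : Finset (Sym2 V)) (q : Sym2 V → Prop)
    [DecidablePred q] (f : Sym2 V → ℚ) :
    (∑ h : X × Bool, if q h.1.1 then f h.1.1 else 0) = 2 * ∑ e ∈ X with q e, f e := by
  rw [Fintype.sum_prod_type]
  simp only [Fintype.sum_bool]
  rw [Finset.sum_coe_sort X
    (fun e => (if q e then f e else 0) + (if q e then f e else 0)), Finset.sum_add_distrib,
    ← Finset.sum_filter, two_mul]

theorem wSum_symmDiff [DecidableEq V] (w : Sym2 V → ℚ) {A₁ A₂ P : Finset (Sym2 V)}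
    (hP : P ⊆ symmDiff A₁ A₂) :
    wSum w (symmDiff A₂ P) = wSum w A₂ + ∑ e ∈ P, if e ∈ A₁ then w e else -w e := by
  have hsplit : symmDiff A₂ P = (A₂ \ P) ∪ (P \ A₂) := rfl
  rw [hsplit, wSum_union w disjoint_sdiff_sdiff]
  have h1 : wSum w (A₂ \ P) + wSum w (P ∩ A₂) = wSum w A₂ := by
    rw [Finset.inter_comm]
    exact (add_comm _ _).trans (Finset.sum_inter_add_sum_sdiff _ _ _)
  have h2 : ∑ e ∈ P, (if e ∈ A₁ then w e else -w e) = wSum w (P \ A₂) - wSum w (P ∩ A₂) := by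
    rw [← Finset.sum_inter_add_sum_sdiff P A₂, add_comm, wSum, wSum, sub_eq_add_neg,
      ← Finset.sum_neg_distrib]
    congr 1 <;> refine Finset.sum_congr rfl fun e he => ?_
    · have := Finset.mem_symmDiff.1 (hP (Finset.mem_sdiff.1 he).1)
      have := (Finset.mem_sdiff.1 he).2
      rw [if_pos (by tauto)]
    · have := Finset.mem_symmDiff.1 (hP (Finset.mem_inter.1 he).1)
      have := (Finset.mem_inter.1 he).2
      rw [if_neg (by tauto)]
  linarith

/-- Lemma 5 of the paper, case with no forbidden triangles: given a finite
edge-weighted graph (self-loops allowed, no parallel edges) and two 2-matchings `A₁, A₂` with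
`(1-ε) w(A₁) > w(A₂)`, there is an alternating trail `P` w.r.t. `(A₁, A₂)` such that `A₂ Δ P`
is a 2-matching, `w(A₂ Δ P) > w(A₂)`, and `|P| ≤ 3/ε`. -/
theorem stmt2 [Fintype V] [DecidableEq V]
    (E : Finset (Sym2 V)) (w : Sym2 V → ℚ) (hw : ∀ e, 0 ≤ w e)
    (A₁ A₂ : Finset (Sym2 V)) (hA₁E : A₁ ⊆ E) (hA₂E : A₂ ⊆ E)
    (hA₁m : IsTwoMatching A₁) (hA₂m : IsTwoMatching A₂)
    (ε : ℚ) (hε0 : 0 < ε) (hε1 : ε ≤ 1)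
    (hgap : (1 - ε) * wSum w A₁ > wSum w A₂) :
    ∃ (k : ℕ) (u : ℕ → V), IsAltTrail A₁ A₂ k u ∧
      IsTwoMatching (symmDiff A₂ (trailEdges k u)) ∧
      wSum w A₂ < wSum w (symmDiff A₂ (trailEdges k u)) ∧
      (k : ℚ) ≤ 3 / ε := by
  obtain ⟨s, hs1, hs2⟩ : ∃ s : ℕ, 1 ≤ ((s : ℚ) + 1) * ε ∧ (s : ℚ) * ε < 1 := by
    have h0 : 1 ≤ ⌈1 / ε⌉₊ := Nat.ceil_pos.2 (by positivity)
    refine ⟨⌈1 / ε⌉₊ - 1, ?_, ?_⟩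
    · rw [Nat.cast_sub h0, Nat.cast_one, sub_add_cancel, ← div_le_iff₀ hε0]
      exact Nat.le_ceil _
    · rw [Nat.cast_sub h0, Nat.cast_one, ← lt_div_iff₀ hε0, sub_lt_iff_lt_add]
      exact Nat.ceil_lt_add_one (by positivity)
  let H := ↥(symmDiff A₁ A₂) × Bool
  let c : H → Bool := fun h => decide (h.1.1 ∈ A₁)
  let p : H → V := fun h => halfEdgeEnd h.1.1 h.2
  let τ : H → H := fun h => (h.1, !h.2)
  let gain : Sym2 V → ℚ := fun e => if e ∈ A₁ then w e else -w e
  let g : H → ℚ := fun h => gain h.1.1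
  have hτ : Function.Involutive τ := fun h => by simp [τ]
  have hτne : ∀ h, τ h ≠ h := fun h hh => by
    have := congrArg Prod.snd hh
    simp [τ] at this
  have hcτ : ∀ h, c (τ h) = c h := fun h => rfl
  obtain ⟨σ, hσ, hp, hcσ, hmax⟩ := exists_maximal_pairing c p
  have hsumfalse : (∑ h, if c h = false then g h else 0) = -(2 * wSum w (A₂ \ A₁)) := by
    have h1 := sum_halfEdges_ite (symmDiff A₁ A₂) (fun e => e ∉ A₁) gain
    have h2 : (symmDiff A₁ A₂).filter (fun e => e ∉ A₁) = A₂ \ A₁ := by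
      ext e; simp only [Finset.mem_filter, Finset.mem_symmDiff, Finset.mem_sdiff]; tauto
    rw [h2] at h1
    have h3 : ∑ e ∈ A₂ \ A₁, gain e = -wSum w (A₂ \ A₁) := by
      rw [wSum, ← Finset.sum_neg_distrib]
      exact Finset.sum_congr rfl fun e he => if_neg (Finset.mem_sdiff.1 he).2
    rw [h3] at h1
    simpa [c, g] using h1
  have hsumtrue : (∑ h, if c h = true then g h else 0) = 2 * wSum w (A₁ \ A₂) := by
    have h1 := sum_halfEdges_ite (symmDiff A₁ A₂) (fun e => e ∈ A₁) gain
    have h2 : (symmDiff A₁ A₂).filter (fun e => e ∈ A₁) = A₁ \ A₂ := by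
      ext e; simp only [Finset.mem_filter, Finset.mem_symmDiff, Finset.mem_sdiff]; tauto
    rw [h2] at h1
    have h3 : ∑ e ∈ A₁ \ A₂, gain e = wSum w (A₁ \ A₂) :=
      Finset.sum_congr rfl fun e he => if_pos (Finset.mem_sdiff.1 he).1
    rw [h3] at h1
    simpa [c, g] using h1
  have hpos : 0 < ((s : ℚ) + 1) * (∑ h, if c h = false then g h else 0) +
      s * ∑ h, if c h = true then g h else 0 := by
    rw [hsumfalse, hsumtrue]
    have h1 : wSum w (A₁ \ A₂) + wSum w (A₁ ∩ A₂) = wSum w A₁ :=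
      (add_comm _ _).trans (Finset.sum_inter_add_sum_sdiff _ _ _)
    have h2 : wSum w (A₂ \ A₁) + wSum w (A₁ ∩ A₂) = wSum w A₂ := by
      rw [Finset.inter_comm]
      exact (add_comm _ _).trans (Finset.sum_inter_add_sum_sdiff _ _ _)
    have h3 : 0 ≤ wSum w (A₁ ∩ A₂) := Finset.sum_nonneg fun e _ => hw e
    have h4 : 0 ≤ wSum w (A₁ \ A₂) := Finset.sum_nonneg fun e _ => hw e
    have h5 : wSum w (A₂ \ A₁) < (1 - ε) * wSum w (A₁ \ A₂) := by
      nlinarith [mul_nonneg hε0.le h3]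
    have h6 : ((s : ℚ) + 1) * wSum w (A₂ \ A₁) <
        ((s : ℚ) + 1) * ((1 - ε) * wSum w (A₁ \ A₂)) :=
      mul_lt_mul_of_pos_left h5 (by positivity)
    nlinarith [mul_le_mul_of_nonneg_right hs1 h4]
  obtain ⟨n, hn, h, hseg, hgain, hinj⟩ := exists_isExchangeable_injOn g hσ hτ
    (exists_isExchangeable_of_sum_pos g hσ hτ hcτ hcσ s hpos)
  set x : ℕ → H := fun i => (σ ∘ τ)^[i] h with hx
  have hxs : ∀ i, x (i + 1) = σ (τ (x i)) := fun i => by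
    simp only [hx, Function.iterate_succ_apply', Function.comp_apply]
  have hedge : ∀ i, s(p (x i), p (x (i + 1))) = (x i).1.1 := fun i => by
    rw [hxs, hp]
    exact mk_halfEdgeEnd _ _
  have hsame : ∀ a b : H, a.1.1 = b.1.1 → a = b ∨ a = τ b := by
    rintro ⟨a, α⟩ ⟨b, β⟩ hab
    obtain rfl : a = b := Subtype.ext hab
    cases α <;> cases β <;> simp [τ]
  have hlt : ∀ i j, i < j → j < n → (x i).1.1 ≠ (x j).1.1 := fun i j hij hj heq => by
    rcases hsame _ _ heq with h1 | h1
    · exact hinj i j hij hj h1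
    · obtain ⟨d, rfl⟩ : ∃ d, j = i + d := ⟨j - i, by omega⟩
      exact iterate_ne_involution_iterate hσ hτ hτne hcτ hcσ hseg.paired d i hj h1
  have hinjx : ∀ i < n, ∀ j < n, (x i).1.1 = (x j).1.1 → i = j := fun i hi j hj heq => by
    rcases lt_trichotomy i j with h1 | h1 | h1
    · exact absurd heq (hlt i j h1 hj)
    · exact h1
    · exact absurd heq.symm (hlt j i h1 hi)
  have htrail : trailEdges n (fun i => p (x i)) = (Finset.range n).image fun i => (x i).1.1 :=
    Finset.image_congr fun i _ => hedge i
  have hsub : trailEdges n (fun i => p (x i)) ⊆ symmDiff A₁ A₂ := by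
    rw [htrail]
    exact Finset.image_subset_iff.2 fun i _ => (x i).1.2
  have hmemP : ∀ a : H, a.1.1 ∈ trailEdges n (fun i => p (x i)) ↔
      ∃ i < n, a = x i ∨ a = τ (x i) := fun a => by
    rw [htrail]
    simp only [Finset.mem_image, Finset.mem_range]
    constructor
    · rintro ⟨i, hi, he⟩
      exact ⟨i, hi, hsame _ _ he.symm⟩
    · rintro ⟨i, hi, rfl | rfl⟩
      · exact ⟨i, hi, rfl⟩
      · exact ⟨i, hi, rfl⟩
  refine ⟨n, fun i => p (x i), ⟨⟨fun i _ => ?_, fun i hi j hj heq => ?_⟩, fun i hi => ?_⟩,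
    ?_, ?_, ?_⟩
  · rw [hedge]
    exact (x i).1.2
  · rw [hedge, hedge] at heq
    exact hinjx i hi j hj heq
  · have hc : c (x (i + 1)) = !c (x i) := by
      rw [hxs, hcσ _ (hseg.paired i hi), hcτ]
    have h1 := Finset.mem_symmDiff.1 (x i).1.2
    have h2 := Finset.mem_symmDiff.1 (x (i + 1)).1.2
    have h3 : (x (i + 1)).1.1 ∈ A₁ ↔ (x i).1.1 ∉ A₁ := by
      by_cases h4 : (x i).1.1 ∈ A₁ <;> simpa [c, h4] using hc
    rw [hedge, hedge (i + 1), Finset.mem_sdiff, Finset.mem_sdiff]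
    tauto
  · refine isTwoMatching_symmDiff_of_pairing hA₁m hA₂m hsub hσ hp (fun a ha => ?_)
      (fun a b hab ha hb => ?_) (fun a ha haP hne => ?_)
    · have hc := hcσ a ha
      by_cases h4 : a.1.1 ∈ A₁ <;> simpa [c, h4] using hc
    · simpa [c] using hmax a b hab ha hb
    · exact (hmemP _).2 (hseg.exists_partner hσ hcτ (by simpa [c] using ha) hne ((hmemP a).1 haP))
  · rw [wSum_symmDiff w hsub, htrail, Finset.sum_image fun i hi j hj =>
      hinjx i (Finset.mem_range.1 hi) j (Finset.mem_range.1 hj)]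
    exact lt_add_of_pos_right _ hgain
  · rw [le_div_iff₀ hε0]
    have h1 : (n : ℚ) ≤ 2 * s + 1 := by exact_mod_cast hn
    nlinarith [mul_le_mul_of_nonneg_right h1 hε0.le]
end

section
/- Let G be a graph, let 𝒯 be a subset of the triangles of G, let M be a 2-matching of G, and let T be any triangle of G (possibly T ∉ 𝒯). If |M ∩ T| = 2, then M is 𝒯(T)-free, i.e., M contains no triangle of 𝒯 that shares an edge with T. -/
open Finset

variable {V : Type*}

theorem IsTriangle.card_eq [DecidableEq V] {T : Finset (Sym2 V)} (hT : IsTriangle T) :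
    T.card = 3 := by
  obtain ⟨a, b, c, hab, hac, hbc, rfl⟩ := hT
  refine card_eq_three.mpr ⟨_, _, _, ?_, ?_, ?_, rfl⟩ <;>
    simp [hab, hac, hbc, hab.symm]

theorem IsTriangle.exists_third [DecidableEq V] {T : Finset (Sym2 V)} (hT : IsTriangle T)
    {x y : V} (h : s(x, y) ∈ T) : ∃ w, w ≠ x ∧ s(y, w) ∈ T ∧ s(x, w) ∈ T := by
  obtain ⟨a, b, c, hab, hac, hbc, rfl⟩ := hT
  simp only [mem_insert, mem_singleton, Sym2.eq_iff] at h
  rcases h with (⟨rfl, rfl⟩ | ⟨rfl, rfl⟩) | (⟨rfl, rfl⟩ | ⟨rfl, rfl⟩) | (⟨rfl, rfl⟩ | ⟨rfl, rfl⟩)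
  · exact ⟨c, hac.symm, by simp, by simp⟩
  · exact ⟨c, hbc.symm, by simp, by simp⟩
  · exact ⟨a, hab, by simp, by simp⟩
  · exact ⟨a, hac, by simp, by simp⟩
  · exact ⟨b, hab.symm, by simp, by simp⟩
  · exact ⟨b, hbc, by simp, by simp⟩

theorem card_filter_mem_le_sym2Deg [DecidableEq V] (F : Finset (Sym2 V)) (v : V) :
    (F.filter (v ∈ ·)).card ≤ sym2Deg F v := by
  rw [card_filter, sym2Deg]
  refine sum_le_sum fun e _ => ?_
  split_ifs <;> simp

theorem IsTwoMatching.eq_of_mem [DecidableEq V] {M : Finset (Sym2 V)} (hM : IsTwoMatching M)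
    {v a b c : V} (ha : s(v, a) ∈ M) (hb : s(v, b) ∈ M) (hc : s(v, c) ∈ M)
    (hab : a ≠ b) (hac : a ≠ c) : b = c := by
  by_contra hbc
  have hsub : ({s(v, a), s(v, b), s(v, c)} : Finset (Sym2 V)) ⊆ M.filter (v ∈ ·) := by
    simp [insert_subset_iff, ha, hb, hc]
  have hcard : ({s(v, a), s(v, b), s(v, c)} : Finset (Sym2 V)).card = 3 :=
    card_eq_three.mpr ⟨_, _, _, mt Sym2.congr_right.mp hab, mt Sym2.congr_right.mp hac,
      mt Sym2.congr_right.mp hbc, rfl⟩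
  have := card_le_card hsub
  have := card_filter_mem_le_sym2Deg M v
  have := hM v
  omega

theorem IsTwoMatching.mem_of_triangle_subset [DecidableEq V] {M T : Finset (Sym2 V)}
    (hM : IsTwoMatching M) (hT : IsTriangle T) (hTM : T ⊆ M) {x y z : V} (hxz : x ≠ z)
    (hxy : s(x, y) ∈ T) (hyz : s(y, z) ∈ M) : s(x, z) ∈ M := by
  obtain ⟨w, hwx, hyw, hxw⟩ := hT.exists_third hxy
  have hyx : s(y, x) ∈ M := by rw [Sym2.eq_swap]; exact hTM hxy
  obtain rfl : w = z := hM.eq_of_mem hyx (hTM hyw) hyz hwx.symm hxz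
  exact hTM hxw

/-- Observation 1 of the paper: if `M` is a 2-matching and `T` is a triangle
of `G` with `|M ∩ T| = 2`, then `M` contains no triangle of `𝒯` sharing an edge with `T`. -/
theorem stmt3 [Fintype V] [DecidableEq V]
    (E : Finset (Sym2 V))
    (𝒯 : Finset (Finset (Sym2 V))) (h𝒯 : ∀ T' ∈ 𝒯, IsTriangle T' ∧ T' ⊆ E)
    (M : Finset (Sym2 V)) (hME : M ⊆ E) (hMm : IsTwoMatching M)
    (T : Finset (Sym2 V)) (hT : IsTriangle T) (hTE : T ⊆ E)
    (hMT : (M ∩ T).card = 2) :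
    ∀ T' ∈ 𝒯, (∃ e ∈ T', e ∈ T) → ¬ T' ⊆ M := by
  rintro T' hT' ⟨e, heT', heT⟩ hT'M
  have hTri := (h𝒯 T' hT').1
  have hnot : ¬ T ⊆ M := by
    intro h
    rw [inter_eq_right.mpr h, hT.card_eq] at hMT
    omega
  have key {x y z : V} (hxz : x ≠ z) (hyz : y ≠ z) (hT : T = {s(x, y), s(y, z), s(x, z)})
      (hxy : s(x, y) ∈ T') : False := by
    have hyx : s(y, x) ∈ T' := by rwa [Sym2.eq_swap]
    have hone : s(y, z) ∈ M ∨ s(x, z) ∈ M := by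
      by_contra! h
      have hsub : M ∩ T ⊆ {s(x, y)} := by
        intro f hf
        simp only [hT, mem_inter, mem_insert, mem_singleton] at hf ⊢
        rcases hf with ⟨hfM, rfl | rfl | rfl⟩
        · rfl
        · exact absurd hfM h.1
        · exact absurd hfM h.2
      have := card_le_card hsub
      simp [hMT] at this
    have hboth : s(y, z) ∈ M ∧ s(x, z) ∈ M :=
      hone.elim (fun h => ⟨h, hMm.mem_of_triangle_subset hTri hT'M hxz hxy h⟩)
        (fun h => ⟨hMm.mem_of_triangle_subset hTri hT'M hyz hyx h, h⟩)
    exact hnot (by simp [hT, insert_subset_iff, hT'M hxy, hboth])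
  obtain ⟨a, b, c, hab, hac, hbc, hTeq⟩ := hT
  rw [hTeq] at heT
  simp only [mem_insert, mem_singleton] at heT
  rcases heT with rfl | rfl | rfl
  · exact key hac hbc hTeq heT'
  · refine key hab.symm hac.symm ?_ heT'
    rw [hTeq]; ext f; simp [Sym2.eq_swap (a := c), Sym2.eq_swap (a := b) (b := a)]; tauto
  · refine key hab hbc.symm ?_ heT'
    rw [hTeq]; ext f; simp [Sym2.eq_swap (a := c) (b := b)]; tauto
end

section
/- Let G be a graph (self-loops allowed, no parallel edges), let 𝒯 be a subset of the triangles of G, and let A₁, A₂ be two 𝒯-free 2-matchings of G. Let u₁, u₂, u₃, u₄ be four distinct nodes such that T = {u₁u₂, u₂u₃, u₁u₃} ∈ 𝒯 and T' = {u₂u₄, u₂u₃, u₃u₄} ∈ 𝒯, with {u₁u₂, u₁u₃, u₂u₄, u₃u₄} ⊆ A₂\A₁ and u₂u₃ ∈ A₁\A₂. Assume moreover that every triangle of 𝒯 is contained in A₁ ∪ A₂, and that there is no triangle T'' ∈ 𝒯 with |A₁ ∩ T''| = 2 such that A₁ΔT'' is 𝒯-free. Then every triangle in 𝒯(T ∪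 T') has its node set contained in {u₁, u₂, u₃, u₄}. -/
open Finset

variable {V : Type*}

/-- At most two edges of a 2-matching that are not self-loops meet at a node. -/
theorem IsTwoMatching.eq_or_eq_or_eq [DecidableEq V] {F : Finset (Sym2 V)}
    (hF : IsTwoMatching F) {v a b c : V}
    (ha : s(v, a) ∈ F) (hb : s(v, b) ∈ F) (hc : s(v, c) ∈ F) :
    a = b ∨ a = c ∨ b = c := by
  by_contra! h
  obtain ⟨hab, hac, hbc⟩ := h
  have hsub : ({s(v, a), s(v, b), s(v, c)} : Finset (Sym2 V)) ⊆ F := by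
    simp [insert_subset_iff, ha, hb, hc]
  have hcard : ({s(v, a), s(v, b), s(v, c)} : Finset (Sym2 V)).card = 3 :=
    card_eq_three.2 ⟨_, _, _, Sym2.congr_right.not.2 hab, Sym2.congr_right.not.2 hac,
      Sym2.congr_right.not.2 hbc, rfl⟩
  have hdeg : ({s(v, a), s(v, b), s(v, c)} : Finset (Sym2 V)).card ≤ sym2Deg F v := by
    rw [card_eq_sum_ones]
    refine (sum_le_sum fun e he => ?_).trans (sum_le_sum_of_subset hsub)
    have hv : v ∈ e := by
      simp only [mem_insert, mem_singleton] at he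
      rcases he with rfl | rfl | rfl <;> simp
    split_ifs <;> simp
  have := hF v
  omega

/-- A triangle containing the edge `ab` consists of `ab` and two edges to a third node. -/
theorem IsTriangle.exists_eq_of_mem [DecidableEq V] {T : Finset (Sym2 V)} (hT : IsTriangle T)
    {a b : V} (hab : s(a, b) ∈ T) :
    ∃ x, x ≠ a ∧ x ≠ b ∧ T = {s(a, b), s(b, x), s(a, x)} := by
  obtain ⟨p, q, r, hpq, hpr, hqr, rfl⟩ := hT
  simp only [mem_insert, mem_singleton, Sym2.eq_iff] at hab
  rcases hab with (⟨rfl, rfl⟩ | ⟨rfl, rfl⟩) | (⟨rfl, rfl⟩ | ⟨rfl, rfl⟩) | (⟨rfl, rfl⟩ | ⟨rfl, rfl⟩)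
  · exact ⟨r, hpr.symm, hqr.symm, rfl⟩
  · exact ⟨r, hqr.symm, hpr.symm, by ext e; simp [Sym2.eq_swap]; tauto⟩
  · exact ⟨p, hpq, hpr, by ext e; simp [Sym2.eq_swap]; tauto⟩
  · exact ⟨p, hpr, hpq, by ext e; simp [Sym2.eq_swap]; tauto⟩
  · exact ⟨q, hpq.symm, hqr, by ext e; simp [Sym2.eq_swap]; tauto⟩
  · exact ⟨q, hqr, hpq.symm, by ext e; simp [Sym2.eq_swap]; tauto⟩

/-- If a 𝒯-free 2-matching `A` contains the edges `bx`, `ax` of a triangle `abx`, and `b` is also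
joined in `A` to a node `c ≠ x` with `ac ∉ A`, then exchanging along `abx` keeps `A` 𝒯-free. -/
theorem IsTwoMatching.tFree_symmDiff [DecidableEq V] {𝒯 : Finset (Finset (Sym2 V))}
    (h𝒯 : ∀ T ∈ 𝒯, IsTriangle T) {A : Finset (Sym2 V)} (hA : IsTwoMatching A) (hAf : TFree 𝒯 A)
    {a b c x : V} (hxc : x ≠ c) (hbc : s(b, c) ∈ A) (hac : s(a, c) ∉ A)
    (hbx : s(b, x) ∈ A) (hax : s(a, x) ∈ A) :
    TFree 𝒯 (symmDiff A {s(a, b), s(b, x), s(a, x)}) := by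
  intro S hS hsub
  have hmem : ∀ e ∈ S, e ≠ s(a, b) → e ∈ A ∧ e ≠ s(b, x) := by
    intro e he hne
    have := hsub he
    simp only [mem_symmDiff, mem_insert, mem_singleton] at this
    rcases this with ⟨h1, h2⟩ | ⟨rfl | rfl | rfl, h2⟩ <;> tauto
  have habS : s(a, b) ∈ S := by
    by_contra h
    exact hAf S hS fun e he => (hmem e he fun h' => h (h' ▸ he)).1
  obtain ⟨y, hya, hyb, rfl⟩ := (h𝒯 S hS).exists_eq_of_mem habS
  obtain ⟨hby, hyx⟩ := hmem s(b, y) (by simp)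
    (by rw [Sym2.eq_swap]; exact Sym2.congr_left.not.2 hya)
  obtain ⟨hay, -⟩ := hmem s(a, y) (by simp) (Sym2.congr_right.not.2 hyb)
  rcases hA.eq_or_eq_or_eq hby hbx hbc with rfl | rfl | rfl
  · exact hyx rfl
  · exact hac hay
  · exact hxc rfl

/-- Claim 16 of the paper: under the configuration of Case 6 (no triangle of
`𝒯` avoids `A₁ ∪ A₂`, and no triangle `T''` of `𝒯` has `|A₁ ∩ T''| = 2` with `A₁ Δ T''`
`𝒯`-free), every triangle of `𝒯(T ∪ T')` has its node set contained in `{u₁, u₂, u₃, u₄}`. -/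
theorem stmt9 [Fintype V] [DecidableEq V]
    (E : Finset (Sym2 V)) (w : Sym2 V → ℚ) (hw : ∀ e, 0 ≤ w e)
    (𝒯 : Finset (Finset (Sym2 V))) (h𝒯 : ∀ T'' ∈ 𝒯, IsTriangle T'' ∧ T'' ⊆ E)
    (A₁ A₂ : Finset (Sym2 V)) (hA₁E : A₁ ⊆ E) (hA₂E : A₂ ⊆ E)
    (hA₁m : IsTwoMatching A₁) (hA₂m : IsTwoMatching A₂)
    (hA₁f : TFree 𝒯 A₁) (hA₂f : TFree 𝒯 A₂)
    (u₁ u₂ u₃ u₄ : V)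
    (h12 : u₁ ≠ u₂) (h13 : u₁ ≠ u₃) (h14 : u₁ ≠ u₄)
    (h23 : u₂ ≠ u₃) (h24 : u₂ ≠ u₄) (h34 : u₃ ≠ u₄)
    (hT : ({s(u₁, u₂), s(u₂, u₃), s(u₁, u₃)} : Finset (Sym2 V)) ∈ 𝒯)
    (hT' : ({s(u₂, u₄), s(u₂, u₃), s(u₃, u₄)} : Finset (Sym2 V)) ∈ 𝒯)
    (he12 : s(u₁, u₂) ∈ A₂ \ A₁) (he13 : s(u₁, u₃) ∈ A₂ \ A₁)
    (he24 : s(u₂, u₄) ∈ A₂ \ A₁) (he34 : s(u₃, u₄) ∈ A₂ \ A₁)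
    (he23 : s(u₂, u₃) ∈ A₁ \ A₂)
    (hcase1 : ∀ T'' ∈ 𝒯, T'' ⊆ A₁ ∪ A₂)
    (hcase5 : ¬ ∃ T'' ∈ 𝒯, (A₁ ∩ T'').card = 2 ∧ TFree 𝒯 (symmDiff A₁ T'')) :
    ∀ T'' ∈ 𝒯,
      (∃ e ∈ T'', e ∈ (({s(u₁, u₂), s(u₂, u₃), s(u₁, u₃)} : Finset (Sym2 V)) ∪
        {s(u₂, u₄), s(u₂, u₃), s(u₃, u₄)})) →
      ∀ e ∈ T'', ∀ v ∈ e, v ∈ ({u₁, u₂, u₃, u₄} : Finset V) := by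
  have hswap : ∀ a b c x : V, a ≠ b → x ≠ c → s(a, b) ∉ A₁ → s(b, c) ∈ A₁ →
      s(a, c) ∉ A₁ → s(b, x) ∈ A₁ → s(a, x) ∈ A₁ →
      ({s(a, b), s(b, x), s(a, x)} : Finset (Sym2 V)) ∉ 𝒯 := by
    intro a b c x hne hxc hab hbc hac hbx hax hmem
    refine hcase5 ⟨_, hmem, ?_, hA₁m.tFree_symmDiff (fun T h => (h𝒯 T h).1) hA₁f hxc hbc hac hbx
      hax⟩
    rw [inter_insert_of_notMem hab, inter_eq_right.2 (by simp [insert_subset_iff, hbx, hax])]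
    exact card_pair (Sym2.congr_left.not.2 hne.symm)
  simp only [mem_sdiff] at he12 he13 he24 he34 he23
  obtain ⟨h12A₂, h12A₁⟩ := he12
  obtain ⟨h13A₂, h13A₁⟩ := he13
  obtain ⟨h24A₂, h24A₁⟩ := he24
  obtain ⟨h34A₂, h34A₁⟩ := he34
  have h23A₁ := he23.1
  have h21A₂ := Sym2.eq_swap (a := u₁) (b := u₂) ▸ h12A₂
  have h31A₂ := Sym2.eq_swap (a := u₁) (b := u₃) ▸ h13A₂
  have h42A₂ := Sym2.eq_swap (a := u₂) (b := u₄) ▸ h24A₂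
  have h43A₂ := Sym2.eq_swap (a := u₃) (b := u₄) ▸ h34A₂
  have h32A₁ := Sym2.eq_swap (a := u₂) (b := u₃) ▸ h23A₁
  have h42A₁ := Sym2.eq_swap (a := u₂) (b := u₄) ▸ h24A₁
  have h43A₁ := Sym2.eq_swap (a := u₃) (b := u₄) ▸ h34A₁
  have hout : ∀ a x : V, a ∈ ({u₁, u₂, u₃, u₄} : Finset V) → x ∉ ({u₁, u₂, u₃, u₄} : Finset V) →
      s(a, x) ∉ A₂ := by
    intro a x ha hx hax
    simp only [mem_insert, mem_singleton, not_or] at ha hx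
    rcases ha with rfl | rfl | rfl | rfl
    · have := hA₂m.eq_or_eq_or_eq hax h12A₂ h13A₂; tauto
    · have := hA₂m.eq_or_eq_or_eq hax h21A₂ h24A₂; tauto
    · have := hA₂m.eq_or_eq_or_eq hax h31A₂ h34A₂; tauto
    · have := hA₂m.eq_or_eq_or_eq hax h42A₂ h43A₂; tauto
  have hclosed : ∀ T ∈ 𝒯, ∀ a b : V, s(a, b) ∈ T → a ∈ ({u₁, u₂, u₃, u₄} : Finset V) →
      b ∈ ({u₁, u₂, u₃, u₄} : Finset V) →
      (∀ x ∉ ({u₁, u₂, u₃, u₄} : Finset V), s(b, x) ∈ A₁ → s(a, x) ∈ A₁ →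
        ({s(a, b), s(b, x), s(a, x)} : Finset (Sym2 V)) ∉ 𝒯) →
      ∀ e ∈ T, ∀ v ∈ e, v ∈ ({u₁, u₂, u₃, u₄} : Finset V) := by
    intro T hT a b habT ha hb hno
    obtain ⟨x, -, -, rfl⟩ := (h𝒯 T hT).1.exists_eq_of_mem habT
    have hx : x ∈ ({u₁, u₂, u₃, u₄} : Finset V) := by
      by_contra hx
      have hbx := mem_union.1 (hcase1 _ hT (show s(b, x) ∈ _ by simp))
      have hax := mem_union.1 (hcase1 _ hT (show s(a, x) ∈ _ by simp))
      exact hno x hx (hbx.resolve_right (hout b x hb hx)) (hax.resolve_right (hout a x ha hx)) hT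
    intro e he v hv
    rw [mem_insert, mem_insert, mem_singleton] at he
    rcases he with rfl | rfl | rfl <;> rcases Sym2.mem_iff.1 hv with rfl | rfl <;> assumption
  have hno23 : ∀ x ∉ ({u₁, u₂, u₃, u₄} : Finset V), s(u₃, x) ∈ A₁ → s(u₂, x) ∈ A₁ →
      ({s(u₂, u₃), s(u₃, x), s(u₂, x)} : Finset (Sym2 V)) ∉ 𝒯 := fun x _ h3x h2x hmem =>
    hA₁f _ hmem (by simp [insert_subset_iff, h23A₁, h3x, h2x])
  rintro T hT ⟨e, heT, he⟩
  simp only [mem_union, mem_insert, mem_singleton] at he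
  rcases he with (rfl | rfl | rfl) | rfl | rfl | rfl
  · refine hclosed T hT u₁ u₂ heT (by simp) (by simp) fun x hx => ?_
    simp only [mem_insert, mem_singleton, not_or] at hx
    exact hswap u₁ u₂ u₃ x h12 hx.2.2.1 h12A₁ h23A₁ h13A₁
  · exact hclosed T hT u₂ u₃ heT (by simp) (by simp) hno23
  · refine hclosed T hT u₁ u₃ heT (by simp) (by simp) fun x hx => ?_
    simp only [mem_insert, mem_singleton, not_or] at hx
    exact hswap u₁ u₃ u₂ x h13 hx.2.1 h13A₁ h32A₁ h12A₁
  · refine hclosed T hT u₄ u₂ (Sym2.eq_swap ▸ heT) (by simp) (by simp) fun x hx => ?_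
    simp only [mem_insert, mem_singleton, not_or] at hx
    exact hswap u₄ u₂ u₃ x h24.symm hx.2.2.1 h42A₁ h23A₁ h43A₁
  · exact hclosed T hT u₂ u₃ heT (by simp) (by simp) hno23
  · refine hclosed T hT u₄ u₃ (Sym2.eq_swap ▸ heT) (by simp) (by simp) fun x hx => ?_
    simp only [mem_insert, mem_singleton, not_or] at hx
    exact hswap u₄ u₃ u₂ x h34.symm hx.2.1 h43A₁ h32A₁ h42A₁
end

section
/- Let G be a graph (self-loops allowed, no parallel edges), let 𝒯 be a subset of the triangles of G, and let A₁, A₂ be two 𝒯-free 2-matchings of G. Let u₁, u₂, u₃, u₄ be four distinct nodes such that T = {u₁u₂, u₂u₃, u₁u₃} ∈ 𝒯 and T' = {u₂u₄, u₂u₃, u₃u₄} ∈ 𝒯, with {u₁u₂, u₁u₃, u₂u₄, u₃u₄} ⊆ A₁\A₂, u₂u₃ ∈ A₂\A₁, and u₁u₄ ∈ A₂\A₁. Assume that every triangle of 𝒯(T ∪ T') has its node set contained in {u₁, u₂, u₃, u₄}, and that w(u₁u₂) + w(u₃u₄) > w(u₁u₄) + w(u₂u₃). Then the closed alternating trail P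 = u₄u₁, u₁u₂, u₂u₃, u₃u₄ satisfies: A₂ΔP is a 𝒯-free 2-matching, w(A₂ΔP) > w(A₂), and |P| + 2·sl(P) = 4. -/
open Finset

variable {V : Type*}

theorem sum_symmDiff_four {α M : Type*} [DecidableEq α] [AddCommMonoid M] (f : α → M)
    {A : Finset α} {a b c d : α} (ha : a ∈ A) (hb : b ∉ A) (hc : c ∈ A) (hd : d ∉ A)
    (hac : a ≠ c) (hbd : b ≠ d) :
    (∑ x ∈ symmDiff A {a, b, c, d}, f x) + (f a + f c) = (∑ x ∈ A, f x) + (f b + f d) := by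
  have hab : a ≠ b := ne_of_mem_of_not_mem ha hb
  have had : a ≠ d := ne_of_mem_of_not_mem ha hd
  have hcb : c ≠ b := ne_of_mem_of_not_mem hc hb
  have hcd : c ≠ d := ne_of_mem_of_not_mem hc hd
  have hS : symmDiff A {a, b, c, d} = (A \ {a, c}) ∪ {b, d} := by
    ext x
    simp only [mem_symmDiff, mem_union, mem_sdiff, mem_insert, mem_singleton]
    grind
  have hdisj : Disjoint (A \ {a, c}) {b, d} := by
    simp [Finset.disjoint_right, hb, hd]
  have hsub : ({a, c} : Finset α) ⊆ A := by
    simp [Finset.insert_subset_iff, ha, hc]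
  rw [hS, sum_union hdisj, ← sum_sdiff hsub, sum_pair hac, sum_pair hbd, add_right_comm]

theorem not_triangle_subset_of_four [DecidableEq V] {T F : Finset (Sym2 V)} (hT : IsTriangle T)
    {p q r s : V} (hpq : s(p, q) ∉ F) (hrs : s(r, s) ∉ F)
    (hnodes : ∀ e ∈ T, ∀ v ∈ e, v ∈ ({p, q, r, s} : Finset V)) : ¬ T ⊆ F := by
  obtain ⟨a, b, c, hab, hac, hbc, rfl⟩ := hT
  intro hsub
  have eab : s(a, b) ∈ F := hsub (by simp)
  have ebc : s(b, c) ∈ F := hsub (by simp)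
  have eac : s(a, c) ∈ F := hsub (by simp)
  have ha := hnodes s(a, b) (by simp) a (by simp)
  have hb := hnodes s(a, b) (by simp) b (by simp)
  have hc := hnodes s(b, c) (by simp) c (by simp)
  have hqp : s(q, p) ∉ F := by rwa [Sym2.eq_swap]
  have hsr : s(s, r) ∉ F := by rwa [Sym2.eq_swap]
  simp only [mem_insert, mem_singleton] at ha hb hc
  grind

theorem sym2Deg_term_pair [DecidableEq V] {a b : V} (hab : a ≠ b) (v : V) :
    (if s(a, b) = s(v, v) then 2 else if v ∈ s(a, b) then 1 else 0) =
      (if v = a then 1 else 0) + (if v = b then 1 else 0) := by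
  simp only [Sym2.eq_iff, Sym2.mem_iff]
  grind

/-- first part of Case 5.1 of the paper: with
`{u₁u₂, u₁u₃, u₂u₄, u₃u₄} ⊆ A₁ \ A₂`, `u₂u₃, u₁u₄ ∈ A₂ \ A₁`, every triangle of `𝒯(T ∪ T')`
having node set inside `{u₁, u₂, u₃, u₄}`, and `w(u₁u₂) + w(u₃u₄) > w(u₁u₄) + w(u₂u₃)`,
the closed alternating trail `P = u₄u₁, u₁u₂, u₂u₃, u₃u₄` satisfies: `A₂ Δ P` is a `𝒯`-free
2-matching, `w(A₂ Δ P) > w(A₂)`, and `|P| + 2 sl(P) = 4`. -/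
theorem stmt10 [Fintype V] [DecidableEq V]
    (E : Finset (Sym2 V)) (w : Sym2 V → ℚ) (hw : ∀ e, 0 ≤ w e)
    (𝒯 : Finset (Finset (Sym2 V))) (h𝒯 : ∀ T'' ∈ 𝒯, IsTriangle T'' ∧ T'' ⊆ E)
    (A₁ A₂ : Finset (Sym2 V)) (hA₁E : A₁ ⊆ E) (hA₂E : A₂ ⊆ E)
    (hA₁m : IsTwoMatching A₁) (hA₂m : IsTwoMatching A₂)
    (hA₁f : TFree 𝒯 A₁) (hA₂f : TFree 𝒯 A₂)
    (u₁ u₂ u₃ u₄ : V)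
    (h12 : u₁ ≠ u₂) (h13 : u₁ ≠ u₃) (h14 : u₁ ≠ u₄)
    (h23 : u₂ ≠ u₃) (h24 : u₂ ≠ u₄) (h34 : u₃ ≠ u₄)
    (hT : ({s(u₁, u₂), s(u₂, u₃), s(u₁, u₃)} : Finset (Sym2 V)) ∈ 𝒯)
    (hT' : ({s(u₂, u₄), s(u₂, u₃), s(u₃, u₄)} : Finset (Sym2 V)) ∈ 𝒯)
    (he12 : s(u₁, u₂) ∈ A₁ \ A₂) (he13 : s(u₁, u₃) ∈ A₁ \ A₂)
    (he24 : s(u₂, u₄) ∈ A₁ \ A₂) (he34 : s(u₃, u₄) ∈ A₁ \ A₂)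
    (he23 : s(u₂, u₃) ∈ A₂ \ A₁) (he14 : s(u₁, u₄) ∈ A₂ \ A₁)
    (hclaim : ∀ T'' ∈ 𝒯,
      (∃ e ∈ T'', e ∈ (({s(u₁, u₂), s(u₂, u₃), s(u₁, u₃)} : Finset (Sym2 V)) ∪
        {s(u₂, u₄), s(u₂, u₃), s(u₃, u₄)})) →
      ∀ e ∈ T'', ∀ v ∈ e, v ∈ ({u₁, u₂, u₃, u₄} : Finset V))
    (hweight : w s(u₁, u₄) + w s(u₂, u₃) < w s(u₁, u₂) + w s(u₃, u₄)) :
    IsAltTrail A₁ A₂ 4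
      (fun i => if i = 1 then u₁ else if i = 2 then u₂ else if i = 3 then u₃ else u₄) ∧
    trailEdges 4
      (fun i => if i = 1 then u₁ else if i = 2 then u₂ else if i = 3 then u₃ else u₄) =
      ({s(u₄, u₁), s(u₁, u₂), s(u₂, u₃), s(u₃, u₄)} : Finset (Sym2 V)) ∧
    IsTwoMatching (symmDiff A₂ ({s(u₄, u₁), s(u₁, u₂), s(u₂, u₃), s(u₃, u₄)} : Finset (Sym2 V))) ∧
    TFree 𝒯 (symmDiff A₂ ({s(u₄, u₁), s(u₁, u₂), s(u₂, u₃), s(u₃, u₄)} : Finset (Sym2 V))) ∧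
    wSum w A₂ <
      wSum w (symmDiff A₂ ({s(u₄, u₁), s(u₁, u₂), s(u₂, u₃), s(u₃, u₄)} : Finset (Sym2 V))) ∧
    ({s(u₄, u₁), s(u₁, u₂), s(u₂, u₃), s(u₃, u₄)} : Finset (Sym2 V)).card +
      2 * (({s(u₄, u₁), s(u₁, u₂), s(u₂, u₃), s(u₃, u₄)} : Finset (Sym2 V)).filter
        Sym2.IsDiag).card = 4 := by
  simp only [mem_sdiff] at he12 he13 he24 he34 he23 he14
  have he41 : s(u₄, u₁) ∈ A₂ ∧ s(u₄, u₁) ∉ A₁ := by rwa [Sym2.eq_swap]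
  have hne : s(u₄, u₁) ≠ s(u₂, u₃) := by
    simp only [ne_eq, Sym2.eq_iff]
    grind
  have hne' : s(u₁, u₂) ≠ s(u₃, u₄) := by
    simp only [ne_eq, Sym2.eq_iff]
    grind
  have hsum {M : Type} [AddCommMonoid M] (f : Sym2 V → M) :=
    sum_symmDiff_four f he41.1 he12.2 he23.1 he34.2 hne hne'
  refine ⟨⟨⟨?_, ?_⟩, ?_⟩, ?_, ?_, ?_, ?_, ?_⟩
  · intro i hi
    interval_cases i <;> simp [mem_symmDiff, *]
  · intro i hi j hj
    interval_cases i <;> interval_cases j <;> simp <;> grind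
  · intro i hi
    have : i < 3 := by omega
    interval_cases i <;> simp [*]
  · simp [trailEdges, Finset.range_add_one, Finset.image_insert]
    grind
  · intro v
    have h := hsum fun e => if e = s(v, v) then 2 else if v ∈ e then 1 else 0
    simp only [sym2Deg_term_pair h14.symm, sym2Deg_term_pair h12, sym2Deg_term_pair h23,
      sym2Deg_term_pair h34] at h
    have hv := hA₂m v
    simp only [sym2Deg] at hv ⊢
    omega
  · intro S hS
    by_cases hmeet : s(u₁, u₂) ∈ S ∨ s(u₃, u₄) ∈ S
    · have hnodes := hclaim S hS (by
        rcases hmeet with h | h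
        · exact ⟨_, h, by simp⟩
        · exact ⟨_, h, by simp⟩)
      refine not_triangle_subset_of_four (p := u₄) (q := u₁) (r := u₂) (s := u₃) (h𝒯 S hS).1
        ?_ ?_ ?_
      · simp [mem_symmDiff, he41]
      · simp [mem_symmDiff, he23]
      · intro e he v hv
        have := hnodes e he v hv
        simp only [mem_insert, mem_singleton] at this ⊢
        tauto
    · intro hsub
      refine hA₂f S hS fun e he => ?_
      have := hsub he
      simp only [mem_symmDiff, mem_insert, mem_singleton] at this
      grind
  · have h := hsum w
    rw [Sym2.eq_swap (a := u₁) (b := u₄)] at hweight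
    simp only [wSum]
    linarith
  · have hcard : ({s(u₄, u₁), s(u₁, u₂), s(u₂, u₃), s(u₃, u₄)} : Finset (Sym2 V)).card = 4 := by
      have h1 := ne_of_mem_of_not_mem he41.1 he12.2
      have h2 := ne_of_mem_of_not_mem he41.1 he34.2
      have h3 := ne_of_mem_of_not_mem he23.1 he12.2
      have h4 := ne_of_mem_of_not_mem he23.1 he34.2
      rw [card_insert_of_notMem, card_insert_of_notMem, card_pair h4] <;>
        simp only [mem_insert, mem_singleton] <;> grind
    rw [hcard, filter_eq_empty_iff.2]
    · rfl
    · simp [h12, h23, h34, h14.symm]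
end

section
/- Let G be a graph (self-loops allowed, no parallel edges), let 𝒯 be a subset of the triangles of G, and let A₁, A₂ be two 𝒯-free 2-matchings of G. Let u₁, u₂, u₃ be distinct nodes with T = {u₁u₂, u₂u₃, u₁u₃} ∈ 𝒯, {u₁u₂, u₁u₃} ⊆ A₁\A₂, u₂u₃ ∈ A₂\A₁, and suppose the self-loop u₁u₁ belongs to A₂. If w(u₁u₂) + w(u₁u₃) > w(u₂u₃) + w(u₁u₁), then the trail P = {u₁u₂, u₂u₃, u₁u₃, u₁u₁} satisfies: A₂ΔP is a 𝒯-free 2-matching, w(A₂ΔP) > w(A₂), and |P| + 2·sl(P) = 6. -/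
open Finset

variable {V : Type*}

/-- Swapping two members `c, d` of `A` for two non-members `a, b` shifts any sum accordingly. -/
theorem sum_insert_insert_erase_erase {α M : Type*} [DecidableEq α] [AddCommMonoid M]
    (f : α → M) {A : Finset α} {a b c d : α} (hab : a ≠ b) (hcd : c ≠ d)
    (ha : a ∉ A) (hb : b ∉ A) (hc : c ∈ A) (hd : d ∈ A) :
    (∑ e ∈ insert a (insert b ((A.erase c).erase d)), f e) + (f c + f d) =
      (∑ e ∈ A, f e) + (f a + f b) := by
  rw [sum_insert (by simp [hab, ha]), sum_insert (by simp [hb]), ← add_sum_erase A f hc,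
    ← add_sum_erase (A.erase c) f (mem_erase.2 ⟨hcd.symm, hd⟩)]
  abel

/-- In a 2-matching, a self-loop at `u` is the only edge incident to `u`. -/
theorem IsTwoMatching.eq_loop_of_mem [DecidableEq V] {A : Finset (Sym2 V)}
    (hA : IsTwoMatching A) {u : V} (hu : s(u, u) ∈ A) {e : Sym2 V} (he : e ∈ A) (hue : u ∈ e) :
    e = s(u, u) := by
  by_contra hne
  have h := hA u
  rw [sym2Deg, ← add_sum_erase A _ hu] at h
  have h' := single_le_sum (f := fun e : Sym2 V => if e = s(u, u) then 2 else if u ∈ e then 1 else 0)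
    (fun i _ => Nat.zero_le _) (mem_erase.2 ⟨hne, he⟩)
  simp only [hne, hue, if_true, if_false] at h h'
  omega

/-- first part of Case 3.1 of the paper: with `{u₁u₂, u₁u₃} ⊆ A₁ \ A₂`,
`u₂u₃ ∈ A₂ \ A₁`, the self-loop `u₁u₁ ∈ A₂`, and `w(u₁u₂) + w(u₁u₃) > w(u₂u₃) + w(u₁u₁)`,
the trail `P = {u₁u₂, u₂u₃, u₁u₃, u₁u₁}` satisfies: `A₂ Δ P` is a `𝒯`-free 2-matching,
`w(A₂ Δ P) > w(A₂)`, and `|P| + 2 sl(P) = 6`. -/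
theorem stmt11 [Fintype V] [DecidableEq V]
    (E : Finset (Sym2 V)) (w : Sym2 V → ℚ) (hw : ∀ e, 0 ≤ w e)
    (𝒯 : Finset (Finset (Sym2 V))) (h𝒯 : ∀ T' ∈ 𝒯, IsTriangle T' ∧ T' ⊆ E)
    (A₁ A₂ : Finset (Sym2 V)) (hA₁E : A₁ ⊆ E) (hA₂E : A₂ ⊆ E)
    (hA₁m : IsTwoMatching A₁) (hA₂m : IsTwoMatching A₂)
    (hA₁f : TFree 𝒯 A₁) (hA₂f : TFree 𝒯 A₂)
    (u₁ u₂ u₃ : V) (h12 : u₁ ≠ u₂) (h13 : u₁ ≠ u₃) (h23 : u₂ ≠ u₃)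
    (hT : ({s(u₁, u₂), s(u₂, u₃), s(u₁, u₃)} : Finset (Sym2 V)) ∈ 𝒯)
    (he12 : s(u₁, u₂) ∈ A₁ \ A₂) (he13 : s(u₁, u₃) ∈ A₁ \ A₂)
    (he23 : s(u₂, u₃) ∈ A₂ \ A₁) (hloop : s(u₁, u₁) ∈ A₂)
    (hweight : w s(u₂, u₃) + w s(u₁, u₁) < w s(u₁, u₂) + w s(u₁, u₃)) :
    IsTwoMatching (symmDiff A₂ ({s(u₁, u₂), s(u₂, u₃), s(u₁, u₃), s(u₁, u₁)} : Finset (Sym2 V))) ∧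
    TFree 𝒯 (symmDiff A₂ ({s(u₁, u₂), s(u₂, u₃), s(u₁, u₃), s(u₁, u₁)} : Finset (Sym2 V))) ∧
    wSum w A₂ <
      wSum w (symmDiff A₂ ({s(u₁, u₂), s(u₂, u₃), s(u₁, u₃), s(u₁, u₁)} : Finset (Sym2 V))) ∧
    ({s(u₁, u₂), s(u₂, u₃), s(u₁, u₃), s(u₁, u₁)} : Finset (Sym2 V)).card +
      2 * (({s(u₁, u₂), s(u₂, u₃), s(u₁, u₃), s(u₁, u₁)} : Finset (Sym2 V)).filter
        Sym2.IsDiag).card = 6 := by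
  rw [mem_sdiff] at he12 he13 he23
  have hA : symmDiff A₂ ({s(u₁, u₂), s(u₂, u₃), s(u₁, u₃), s(u₁, u₁)} : Finset (Sym2 V)) =
      insert s(u₁, u₂) (insert s(u₁, u₃) ((A₂.erase s(u₂, u₃)).erase s(u₁, u₁))) := by
    ext e
    simp only [mem_symmDiff, mem_insert, mem_singleton, mem_erase]
    grind
  have hab : s(u₁, u₂) ≠ s(u₁, u₃) := by simp [h13, h23]
  have hcd : s(u₂, u₃) ≠ s(u₁, u₁) := by simp [h12.symm]
  rw [hA]
  refine ⟨fun v => ?_, fun T hT𝒯 hTA => ?_, ?_, ?_⟩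
  · have h := sum_insert_insert_erase_erase
      (fun e : Sym2 V => if e = s(v, v) then 2 else if v ∈ e then 1 else 0)
      hab hcd he12.2 he13.2 he23.1 hloop
    have h2 := hA₂m v
    unfold sym2Deg at h2 ⊢
    simp only [Sym2.mem_iff, Sym2.eq_iff] at h h2 ⊢
    grind
  · have hT23 : s(u₂, u₃) ∉ T := fun h => by
      have := hTA h
      simp [h12.symm, h13.symm] at this
    have hinc : ∀ e ∈ T, u₁ ∈ e → e = s(u₁, u₂) ∨ e = s(u₁, u₃) := fun e he hu => by
      have := hTA he
      simp only [mem_insert, mem_erase] at this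
      rcases this with h | h | ⟨h, -, h'⟩
      · exact .inl h
      · exact .inr h
      · exact absurd (hA₂m.eq_loop_of_mem hloop h' hu) h
    have hnot : ∀ e ∈ T, u₁ ∉ e := by
      obtain ⟨a, b, c, h1, h2, h3, rfl⟩ := (h𝒯 T hT𝒯).1
      simp only [mem_insert, mem_singleton, forall_eq_or_imp, forall_eq, Sym2.mem_iff,
        Sym2.eq_iff] at hT23 hinc ⊢
      grind
    refine hA₂f T hT𝒯 fun e he => ?_
    have := hTA he
    simp only [mem_insert, mem_erase] at this
    rcases this with rfl | rfl | h
    · exact absurd (Sym2.mem_mk_left _ _) (hnot _ he)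
    · exact absurd (Sym2.mem_mk_left _ _) (hnot _ he)
    · exact h.2.2
  · have h := sum_insert_insert_erase_erase w hab hcd he12.2 he13.2 he23.1 hloop
    unfold wSum
    linarith
  · have hP : ({s(u₁, u₂), s(u₂, u₃), s(u₁, u₃), s(u₁, u₁)} : Finset (Sym2 V)).card = 4 := by
      simp [card_insert_of_notMem, h12, h13, h23, h12.symm, h13.symm]
    simp [hP, filter_insert, filter_singleton, h12, h13, h23]
end

section
/- Let G be a graph (self-loops allowed, no parallel edges), let 𝒯 be a subset of the triangles of G, and let A₁, A₂ be two 𝒯-free 2-matchings of G. Let u₁, u₂, u₃ be distinct nodes with T = {u₁u₂, u₂u₃, u₁u₃} ∈ 𝒯, {u₁u₂, u₁u₃} ⊆ A₂\A₁, u₂u₃ ∈ A₁\A₂, suppose the self-loop u₁u₁ belongs to A₁, and assume A₂ΔT is 𝒯-free. If w(u₁u₁) + w(u₂u₃) > w(u₁u₂) + w(u₁u₃), then the trail P = {u₁u₂, u₂u₃, u₁u₃, u₁u₁} satisfies: A₂ΔP = (A₂ΔT) ∪ {u₁u₁} is a 𝒯-free 2-matching, w(A₂ΔP) > w(A₂),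 and |P| + 2·sl(P) = 6. -/
open Finset

variable {V : Type*}

/-- A triangle contains no self-loop. -/
lemma IsTriangle.diag_notMem [DecidableEq V] {T : Finset (Sym2 V)} (hT : IsTriangle T) (v : V) :
    s(v, v) ∉ T := by
  obtain ⟨a, b, c, hab, hac, hbc, rfl⟩ := hT
  simp only [mem_insert, mem_singleton, Sym2.eq_iff]
  grind

/-- A self-loop at a vertex already covered by two distinct proper edges of a 2-matching is not
in the 2-matching. -/
lemma IsTwoMatching.diag_notMem [DecidableEq V] {F : Finset (Sym2 V)} (hF : IsTwoMatching F)
    {a b c : V} (hab : a ≠ b) (hac : a ≠ c) (hbc : b ≠ c)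
    (hb : s(a, b) ∈ F) (hc : s(a, c) ∈ F) : s(a, a) ∉ F := by
  intro ha
  have hsub : ({s(a, a), s(a, b), s(a, c)} : Finset (Sym2 V)) ⊆ F := by
    simp [insert_subset_iff, ha, hb, hc]
  have hle : sym2Deg {s(a, a), s(a, b), s(a, c)} a ≤ sym2Deg F a :=
    sum_le_sum_of_subset hsub
  have hdeg : sym2Deg {s(a, a), s(a, b), s(a, c)} a = 4 := by
    unfold sym2Deg
    rw [sum_insert (by simp [hab, hac]), sum_insert (by simp [hbc, hac]), sum_singleton]
    simp [hab.symm, hac.symm]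
  have := hF a
  omega

/-- Exchanging two elements `a, b` of `A` for two elements `c, d` outside `A` by a symmetric
difference exchanges their contributions to a sum. -/
lemma sum_symmDiff_exchange {α M : Type*} [DecidableEq α] [AddCommMonoid M] (f : α → M)
    {A : Finset α} {a b c d : α} (ha : a ∈ A) (hb : b ∈ A) (hc : c ∉ A) (hd : d ∉ A)
    (hab : a ≠ b) (hcd : c ≠ d) :
    ∑ e ∈ symmDiff A {a, c, b, d}, f e + (f a + f b) = ∑ e ∈ A, f e + (f c + f d) := by
  have hB : symmDiff A {a, c, b, d} = insert c (insert d ((A.erase a).erase b)) := by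
    ext e
    simp only [mem_symmDiff, mem_insert, mem_singleton, mem_erase]
    grind
  have hsum : ∑ e ∈ A, f e = f a + (f b + ∑ e ∈ (A.erase a).erase b, f e) := by
    rw [add_sum_erase _ f (mem_erase.2 ⟨hab.symm, hb⟩), add_sum_erase _ f ha]
  rw [hB, sum_insert (by simp [hc, hcd]), sum_insert (by simp [hd]), hsum]
  abel

/-- first part of Case 4.1 of the paper: with `{u₁u₂, u₁u₃} ⊆ A₂ \ A₁`,
`u₂u₃ ∈ A₁ \ A₂`, the self-loop `u₁u₁ ∈ A₁`, `A₂ Δ T` being `𝒯`-free, and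
`w(u₁u₁) + w(u₂u₃) > w(u₁u₂) + w(u₁u₃)`, the trail `P = {u₁u₂, u₂u₃, u₁u₃, u₁u₁}` satisfies:
`A₂ Δ P = (A₂ Δ T) ∪ {u₁u₁}` is a `𝒯`-free 2-matching, `w(A₂ Δ P) > w(A₂)`, and
`|P| + 2 sl(P) = 6`. -/
theorem stmt12 [Fintype V] [DecidableEq V]
    (E : Finset (Sym2 V)) (w : Sym2 V → ℚ) (hw : ∀ e, 0 ≤ w e)
    (𝒯 : Finset (Finset (Sym2 V))) (h𝒯 : ∀ T' ∈ 𝒯, IsTriangle T' ∧ T' ⊆ E)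
    (A₁ A₂ : Finset (Sym2 V)) (hA₁E : A₁ ⊆ E) (hA₂E : A₂ ⊆ E)
    (hA₁m : IsTwoMatching A₁) (hA₂m : IsTwoMatching A₂)
    (hA₁f : TFree 𝒯 A₁) (hA₂f : TFree 𝒯 A₂)
    (u₁ u₂ u₃ : V) (h12 : u₁ ≠ u₂) (h13 : u₁ ≠ u₃) (h23 : u₂ ≠ u₃)
    (hT : ({s(u₁, u₂), s(u₂, u₃), s(u₁, u₃)} : Finset (Sym2 V)) ∈ 𝒯)
    (he12 : s(u₁, u₂) ∈ A₂ \ A₁) (he13 : s(u₁, u₃) ∈ A₂ \ A₁)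
    (he23 : s(u₂, u₃) ∈ A₁ \ A₂) (hloop : s(u₁, u₁) ∈ A₁)
    (hdT : TFree 𝒯 (symmDiff A₂ ({s(u₁, u₂), s(u₂, u₃), s(u₁, u₃)} : Finset (Sym2 V))))
    (hweight : w s(u₁, u₂) + w s(u₁, u₃) < w s(u₁, u₁) + w s(u₂, u₃)) :
    symmDiff A₂ ({s(u₁, u₂), s(u₂, u₃), s(u₁, u₃), s(u₁, u₁)} : Finset (Sym2 V)) =
      symmDiff A₂ ({s(u₁, u₂), s(u₂, u₃), s(u₁, u₃)} : Finset (Sym2 V)) ∪ {s(u₁, u₁)} ∧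
    IsTwoMatching (symmDiff A₂ ({s(u₁, u₂), s(u₂, u₃), s(u₁, u₃), s(u₁, u₁)} : Finset (Sym2 V))) ∧
    TFree 𝒯 (symmDiff A₂ ({s(u₁, u₂), s(u₂, u₃), s(u₁, u₃), s(u₁, u₁)} : Finset (Sym2 V))) ∧
    wSum w A₂ <
      wSum w (symmDiff A₂ ({s(u₁, u₂), s(u₂, u₃), s(u₁, u₃), s(u₁, u₁)} : Finset (Sym2 V))) ∧
    ({s(u₁, u₂), s(u₂, u₃), s(u₁, u₃), s(u₁, u₁)} : Finset (Sym2 V)).card +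
      2 * (({s(u₁, u₂), s(u₂, u₃), s(u₁, u₃), s(u₁, u₁)} : Finset (Sym2 V)).filter
        Sym2.IsDiag).card = 6 := by
  rw [mem_sdiff] at he12 he13 he23
  have hloop₂ : s(u₁, u₁) ∉ A₂ := hA₂m.diag_notMem h12 h13 h23 he12.1 he13.1
  have hedge : s(u₁, u₂) ≠ s(u₁, u₃) := by simp [h13, h23]
  have hne : s(u₂, u₃) ≠ s(u₁, u₁) := by simp [h12.symm]
  have hexchange {M : Type} [AddCommMonoid M] (f : Sym2 V → M) :=
    sum_symmDiff_exchange f he12.1 he13.1 he23.2 hloop₂ hedge hne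
  have hunion :
      symmDiff A₂ ({s(u₁, u₂), s(u₂, u₃), s(u₁, u₃), s(u₁, u₁)} : Finset (Sym2 V)) =
        symmDiff A₂ ({s(u₁, u₂), s(u₂, u₃), s(u₁, u₃)} : Finset (Sym2 V)) ∪ {s(u₁, u₁)} := by
    ext e
    simp only [mem_symmDiff, mem_insert, mem_singleton, mem_union]
    grind
  refine ⟨hunion, fun v => ?_, fun T' hT' hsub => ?_, ?_, ?_⟩
  · have hdeg := hexchange fun e => if e = s(v, v) then 2 else if v ∈ e then 1 else 0
    have hv := hA₂m v
    unfold sym2Deg at hv ⊢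
    simp only [Sym2.eq_iff, Sym2.mem_iff] at hdeg hv ⊢
    grind
  · refine hdT T' hT' fun e he => ?_
    have he' := hsub he
    rw [hunion, mem_union, mem_singleton] at he'
    exact he'.resolve_right fun h => (h𝒯 T' hT').1.diag_notMem u₁ (h ▸ he)
  · have := hexchange w
    unfold wSum
    linarith
  · have hcard :
        ({s(u₁, u₂), s(u₂, u₃), s(u₁, u₃), s(u₁, u₁)} : Finset (Sym2 V)).card = 4 := by
      rw [card_insert_of_notMem, card_insert_of_notMem, card_pair]
      all_goals simp [h12, h13, h23, h12.symm, h13.symm]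
    have hdiag : ({s(u₁, u₂), s(u₂, u₃), s(u₁, u₃), s(u₁, u₁)} : Finset (Sym2 V)).filter
        Sym2.IsDiag = {s(u₁, u₁)} := by
      simp [filter_insert, filter_singleton, h12, h13, h23]
    rw [hcard, hdiag, card_singleton]
end
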